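/- Let M(S,C) be a configuration category in which every C(β) has enough injectives, and fix α ∈ S. Let i: {α} ↪ U_α be the closed embedding and j: U_α ↪ S the open embedding. Then the composition j_! ∘ i_*: D^b(C(α)) → D^b(M(S,C)) is fully faithful; in particular D^b(C(α)) is naturally a full subcategory of D^b(M(S,C)). -/

import Mathlib

open CategoryTheory CategoryTheory.Limits

universe w v u

/-- A diagram of categories indexed by a poset `S`: for `β ≤ α`, a transition functor
`φ : C α ⥤ C β`, strictly functorial. -/
structure PosetDiagram (S : Type) [PartialOrder S] where
  C : S → Type u
  cat : ∀ α, Category.{v} (C α)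
  φ : ∀ {α β : S}, β ≤ α → (C α ⥤ C β)
  φ_refl : ∀ α, φ (le_refl α) = 𝟭 (C α)
  φ_trans : ∀ {α β γ : S} (h₁ : β ≤ α) (h₂ : γ ≤ β), φ (h₂.trans h₁) = φ h₁ ⋙ φ h₂

attribute [instance] PosetDiagram.cat

variable {S : Type} [PartialOrder S]

/-- Objects of the poset category `M(S,C)`. -/
structure ConfObj (D : PosetDiagram S) where
  F : ∀ α, D.C α
  σ : ∀ {α β : S} (h : β ≤ α), (D.φ h).obj (F α) ⟶ F β
  σ_refl : ∀ α, σ (le_refl α) = eqToHom (by rw [D.φ_refl]; rfl)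
  σ_trans : ∀ {α β γ : S} (h₁ : β ≤ α) (h₂ : γ ≤ β),
      σ (h₂.trans h₁) = eqToHom (by rw [D.φ_trans h₁ h₂]; rfl) ≫ (D.φ h₂).map (σ h₁) ≫ σ h₂

/-- Morphisms in the poset category `M(S,C)`. -/
@[ext]
structure ConfHom {D : PosetDiagram S} (F G : ConfObj D) where
  f : ∀ α, F.F α ⟶ G.F α
  comm : ∀ {α β : S} (h : β ≤ α), (D.φ h).map (f α) ≫ G.σ h = F.σ h ≫ f β

/-- The poset category `M(S,C)`. -/
instance confCategory (D : PosetDiagram S) : Category (ConfObj D) where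
  Hom F G := ConfHom F G
  id F := ⟨fun _ => 𝟙 _, by intro α β h; simp⟩
  comp u v := ⟨fun α => u.f α ≫ v.f α, by
    intro α β h
    rw [Functor.map_comp, Category.assoc, v.comm h, ← Category.assoc, u.comm h, Category.assoc]⟩
  id_comp u := by apply ConfHom.ext; funext α; exact Category.id_comp _
  comp_id u := by apply ConfHom.ext; funext α; exact Category.comp_id _
  assoc u v w := by apply ConfHom.ext; funext α; exact Category.assoc _ _ _

@[simp] lemma conf_id_f (D : PosetDiagram S) (F : ConfObj D) (α : S) :
    (𝟙 F : ConfHom F F).f α = 𝟙 (F.F α) := rfl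

@[simp] lemma conf_comp_f (D : PosetDiagram S) {F G H : ConfObj D} (u : F ⟶ G) (v : G ⟶ H)
    (α : S) : (u ≫ v).f α = u.f α ≫ v.f α := rfl

/-- The evaluation functor `j_α^* : M(S,C) ⥤ C(α)`. -/
def evalF (D : PosetDiagram S) (α : S) : ConfObj D ⥤ D.C α where
  obj F := F.F α
  map u := u.f α

/-- Restriction of a poset diagram to a subset of the poset. -/
def PosetDiagram.restrict (D : PosetDiagram S) (T : Set S) : PosetDiagram T where
  C t := D.C t.1
  cat t := D.cat t.1
  φ h := D.φ h
  φ_refl t := D.φ_refl t.1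
  φ_trans h₁ h₂ := D.φ_trans h₁ h₂

/-- The restriction functor `M(S,C) ⥤ M(T, C|_T)`. -/
def resF (D : PosetDiagram S) (T : Set S) : ConfObj D ⥤ ConfObj (D.restrict T) where
  obj F :=
    { F := fun t => F.F t.1
      σ := fun h => F.σ h
      σ_refl := fun t => F.σ_refl t.1
      σ_trans := fun h₁ h₂ => F.σ_trans h₁ h₂ }
  map u :=
    { f := fun t => u.f t.1
      comm := fun h => u.comm h }

/-- `F` is supported in `T` if all components outside of `T` vanish. -/
def SuppIn {D : PosetDiagram S} (F : ConfObj D) (T : Set S) : Prop :=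
  ∀ α, α ∉ T → IsZero (F.F α)
section DerivedPreamble

variable (A : Type u) [Category.{v} A] [Abelian A] [HasDerivedCategory.{w} A]

/-- An object of the derived category is (cohomologically) bounded. -/
def BoundedObj (X : DerivedCategory A) : Prop :=
  ∃ a b : ℤ, ∀ i : ℤ, (i < a ∨ b < i) → IsZero ((DerivedCategory.homologyFunctor A i).obj X)

/-- The bounded derived category `D^b(A)`, realized as the full subcategory of
cohomologically bounded objects of the derived category. -/
abbrev Db := ObjectProperty.FullSubcategory (BoundedObj A)

variable {A}

lemma boundedObj_single (X : A) :
    BoundedObj A ((DerivedCategory.singleFunctor A 0).obj X) := by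
  refine ⟨0, 0, fun i hi => ?_⟩
  have hne : i ≠ 0 := by rcases hi with h | h <;> omega
  have e : (DerivedCategory.homologyFunctor A i).obj
      ((DerivedCategory.singleFunctor A 0).obj X) ≅
      ((HomologicalComplex.single A (ComplexShape.up ℤ) 0).obj X).homology i :=
    (DerivedCategory.homologyFunctor A i).mapIso
      ((DerivedCategory.quotientCompQhIso A).app
        ((HomologicalComplex.single A (ComplexShape.up ℤ) 0).obj X)) ≪≫
      (DerivedCategory.homologyFunctorFactors A i).app _
  exact (HomologicalComplex.isZero_single_obj_homology _ 0 X i hne).of_iso e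

variable (A)

/-- The canonical functor `A ⥤ D^b(A)` sending `X` to the complex concentrated in degree 0. -/
noncomputable def toDb : A ⥤ Db A :=
  ObjectProperty.lift _ (DerivedCategory.singleFunctor A 0) boundedObj_single

end DerivedPreamble

universe w₁ w₂ v₁ v₂ u₁ u₂

section ExactFunctors

variable {A : Type u₁} [Category.{v₁} A] [Abelian A]
  {B : Type u₂} [Category.{v₂} B] [Abelian B]

/-- An adjunction between additive functors extends to complexes. -/
def adjunctionMapHomologicalComplex {F : A ⥤ B} {G : B ⥤ A} [F.Additive] [G.Additive]
    (adj : F ⊣ G) {ι : Type*} (c : ComplexShape ι) :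
    F.mapHomologicalComplex c ⊣ G.mapHomologicalComplex c where
  unit :=
    { app := fun K =>
        { f := fun _ => adj.unit.app _
          comm' := fun i j _ => (adj.unit.naturality (K.d i j)).symm }
      naturality := fun _ _ f => HomologicalComplex.hom_ext _ _ fun i =>
        adj.unit.naturality (f.f i) }
  counit :=
    { app := fun K =>
        { f := fun _ => adj.counit.app _
          comm' := fun i j _ => (adj.counit.naturality (K.d i j)).symm }
      naturality := fun _ _ f => HomologicalComplex.hom_ext _ _ fun i =>
        adj.counit.naturality (f.f i) }
  left_triangle_components K :=
    HomologicalComplex.hom_ext _ _ fun i => adj.left_triangle_components (K.X i)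
  right_triangle_components K :=
    HomologicalComplex.hom_ext _ _ fun i => adj.right_triangle_components (K.X i)

variable [HasDerivedCategory.{w₁} A] [HasDerivedCategory.{w₂} B]

open DerivedCategory

noncomputable def mapDerivedCategoryCompIso {F : A ⥤ B} {G : B ⥤ A} [F.Additive] [G.Additive]
    [PreservesFiniteLimits F] [PreservesFiniteColimits F]
    [PreservesFiniteLimits G] [PreservesFiniteColimits G] (e : F ⋙ G ≅ 𝟭 A) :
    F.mapDerivedCategory ⋙ G.mapDerivedCategory ≅ 𝟭 (DerivedCategory A) :=
  letI : Localization.Lifting (Q (C := A)) (HomologicalComplex.quasiIso A (ComplexShape.up ℤ))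
      ((F ⋙ G).mapHomologicalComplex (ComplexShape.up ℤ) ⋙ Q)
      (F.mapDerivedCategory ⋙ G.mapDerivedCategory) :=
    ⟨(Functor.associator _ _ _).symm ≪≫
      Functor.isoWhiskerRight F.mapDerivedCategoryFactors _ ≪≫ Functor.associator _ _ _ ≪≫
      Functor.isoWhiskerLeft _ G.mapDerivedCategoryFactors⟩
  Localization.liftNatIso Q (HomologicalComplex.quasiIso A (ComplexShape.up ℤ))
    ((F ⋙ G).mapHomologicalComplex (ComplexShape.up ℤ) ⋙ Q) Q _ _
    (Functor.isoWhiskerRight (NatIso.mapHomologicalComplex e _ ≪≫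
      Functor.mapHomologicalComplexIdIso A _) Q ≪≫ Functor.leftUnitor _)

noncomputable def adjunctionMapDerivedCategory {F : A ⥤ B} {G : B ⥤ A} [F.Additive] [G.Additive]
    [PreservesFiniteLimits F] [PreservesFiniteColimits F]
    [PreservesFiniteLimits G] [PreservesFiniteColimits G] (adj : F ⊣ G) :
    F.mapDerivedCategory ⊣ G.mapDerivedCategory :=
  letI : CatCommSq (F.mapHomologicalComplex (ComplexShape.up ℤ)) Q Q F.mapDerivedCategory :=
    ⟨F.mapDerivedCategoryFactors.symm⟩
  letI : CatCommSq (G.mapHomologicalComplex (ComplexShape.up ℤ)) Q Q G.mapDerivedCategory :=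
    ⟨G.mapDerivedCategoryFactors.symm⟩
  (adjunctionMapHomologicalComplex adj (ComplexShape.up ℤ)).localization
    Q (HomologicalComplex.quasiIso A (ComplexShape.up ℤ))
    Q (HomologicalComplex.quasiIso B (ComplexShape.up ℤ)) _ _

lemma BoundedObj.mapDerivedCategory (F : A ⥤ B) [F.Additive]
    [PreservesFiniteLimits F] [PreservesFiniteColimits F] {X : DerivedCategory A}
    (hX : BoundedObj A X) : BoundedObj B (F.mapDerivedCategory.obj X) := by
  obtain ⟨a, b, h⟩ := hX
  refine ⟨a, b, fun i hi => ?_⟩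
  let K := Q.objPreimage X
  have hK : IsZero (K.homology i) := (h i hi).of_iso
    (((homologyFunctorFactors A i).app K).symm ≪≫
      (homologyFunctor A i).mapIso (Q.objObjPreimageIso X))
  refine (F.map_isZero hK).of_iso ((homologyFunctor B i).mapIso
    (F.mapDerivedCategory.mapIso (Q.objObjPreimageIso X).symm ≪≫
      F.mapDerivedCategoryFactors.app K) ≪≫ (homologyFunctorFactors B i).app _ ≪≫ ?_)
  exact ((K.sc i).mapHomologyIso F)

noncomputable def mapDb (F : A ⥤ B) [F.Additive]
    [PreservesFiniteLimits F] [PreservesFiniteColimits F] : Db A ⥤ Db B :=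
  ObjectProperty.lift _ (ObjectProperty.ι _ ⋙ F.mapDerivedCategory)
    fun X => X.property.mapDerivedCategory F

noncomputable def toDbCompMapDbIso (F : A ⥤ B) [F.Additive]
    [PreservesFiniteLimits F] [PreservesFiniteColimits F] :
    toDb A ⋙ mapDb F ≅ F ⋙ toDb B :=
  ((ObjectProperty.fullyFaithfulι _).whiskeringRight A).preimageIso
    (F.mapDerivedCategorySingleFunctor 0)

lemma mapDb_full (F : A ⥤ B) [F.Additive]
    [PreservesFiniteLimits F] [PreservesFiniteColimits F] [F.mapDerivedCategory.Full] :
    (mapDb F).Full := by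
  unfold mapDb; infer_instance

lemma mapDb_faithful (F : A ⥤ B) [F.Additive]
    [PreservesFiniteLimits F] [PreservesFiniteColimits F] [F.mapDerivedCategory.Faithful] :
    (mapDb F).Faithful := by
  unfold mapDb; infer_instance

end ExactFunctors

section ConfigurationCategory

variable (D : PosetDiagram.{v, u} S)

lemma PosetDiagram.φ_refl_map {α : S} {X Y : D.C α} (f : X ⟶ Y) :
    (D.φ (le_refl α)).map f =
      eqToHom (by rw [D.φ_refl]; rfl) ≫ f ≫ eqToHom (by rw [D.φ_refl]; rfl) :=
  Functor.congr_hom (D.φ_refl α) f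

lemma PosetDiagram.φ_trans_map {α β γ : S} (h₁ : β ≤ α) (h₂ : γ ≤ β) {X Y : D.C α} (f : X ⟶ Y) :
    (D.φ (h₂.trans h₁)).map f = eqToHom (by rw [D.φ_trans h₁ h₂]; rfl) ≫
      (D.φ h₂).map ((D.φ h₁).map f) ≫ eqToHom (by rw [D.φ_trans h₁ h₂]; rfl) :=
  Functor.congr_hom (D.φ_trans h₁ h₂) f

instance (T : Set S) (t : T) [h : ∀ α, Abelian (D.C α)] : Abelian ((D.restrict T).C t) :=
  h t.1

instance (T : Set S) [h : ∀ {α β : S} (h : β ≤ α), PreservesFiniteColimits (D.φ h)]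
    {α β : T} (hβ : β ≤ α) : PreservesFiniteColimits ((D.restrict T).φ hβ) :=
  h (α := α.1) (β := β.1) hβ

/-- A family of objects admitting a jointly monic family of maps to objects of `M(S,C)`, compatible
with structure maps, is an object of `M(S,C)`. -/
def ConfObj.ofJointlyMono {I : Type} (F : I → ConfObj D) (X : ∀ β, D.C β)
    (p : ∀ i β, X β ⟶ (F i).F β)
    (hp : ∀ {β : S} {Z : D.C β} {u v : Z ⟶ X β}, (∀ i, u ≫ p i β = v ≫ p i β) → u = v)
    (σ : ∀ {α β : S} (h : β ≤ α), (D.φ h).obj (X α) ⟶ X β)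
    (hσ : ∀ {α β : S} (h : β ≤ α) (i : I), σ h ≫ p i β = (D.φ h).map (p i α) ≫ (F i).σ h) :
    ConfObj D where
  F := X
  σ := σ
  σ_refl α := hp fun i => by rw [hσ, D.φ_refl_map, (F i).σ_refl]; simp
  σ_trans {α β γ} h₁ h₂ := hp fun i => by
    rw [hσ, D.φ_trans_map h₁ h₂, (F i).σ_trans h₁ h₂]
    simp only [Category.assoc, hσ, eqToHom_trans_assoc, eqToHom_refl, Category.id_comp]
    rw [← Functor.map_comp_assoc, ← Functor.map_comp_assoc, hσ]

/-- A family of objects admitting a family of maps from objects of `M(S,C)`, compatible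
with structure maps and jointly epic after applying the transition functors, is an object
of `M(S,C)`. -/
def ConfObj.ofJointlyEpi {I : Type} (F : I → ConfObj D) (X : ∀ β, D.C β)
    (p : ∀ i β, (F i).F β ⟶ X β)
    (hp : ∀ {α β : S} (h : β ≤ α) {Z : D.C β} {u v : (D.φ h).obj (X α) ⟶ Z},
      (∀ i, (D.φ h).map (p i α) ≫ u = (D.φ h).map (p i α) ≫ v) → u = v)
    (σ : ∀ {α β : S} (h : β ≤ α), (D.φ h).obj (X α) ⟶ X β)
    (hσ : ∀ {α β : S} (h : β ≤ α) (i : I), (D.φ h).map (p i α) ≫ σ h = (F i).σ h ≫ p i β) :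
    ConfObj D where
  F := X
  σ := σ
  σ_refl α := hp _ fun i => by rw [hσ, D.φ_refl_map, (F i).σ_refl]; simp
  σ_trans {α β γ} h₁ h₂ := hp _ fun i => by
    rw [hσ, D.φ_trans_map h₁ h₂, (F i).σ_trans h₁ h₂]
    simp only [Category.assoc, eqToHom_trans_assoc, eqToHom_refl, Category.id_comp]
    rw [← Functor.map_comp_assoc, hσ, Functor.map_comp_assoc, hσ]

variable {D} in
/-- Isomorphisms in `M(S,C)` are constructed componentwise. -/
def ConfObj.isoMk {F G : ConfObj D} (e : ∀ α, F.F α ≅ G.F α)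
    (he : ∀ {α β : S} (h : β ≤ α), (D.φ h).map (e α).hom ≫ G.σ h = F.σ h ≫ (e β).hom) : F ≅ G where
  hom := { f := fun α => (e α).hom, comm := he }
  inv :=
    { f := fun α => (e α).inv
      comm := fun {α β} h => by
        rw [← cancel_mono (e β).hom, Category.assoc, Category.assoc, ← he h,
          ← Functor.map_comp_assoc]
        simp }
  hom_inv_id := ConfHom.ext (funext fun α => (e α).hom_inv_id)
  inv_hom_id := ConfHom.ext (funext fun α => (e α).inv_hom_id)

section Exactness

variable {D}
variable {J : Type} [SmallCategory J] [FinCategory J] {K : J ⥤ ConfObj D}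

/-- Colimits in `M(S,C)` are detected componentwise. -/
def isColimitOfEval [∀ {α β : S} (h : β ≤ α), PreservesFiniteColimits (D.φ h)]
    (c : Cocone K) (hc : ∀ β, IsColimit ((evalF D β).mapCocone c)) : IsColimit c where
  desc s :=
    { f := fun β => (hc β).desc ((evalF D β).mapCocone s)
      comm := fun {α β} h => (isColimitOfPreserves (D.φ h) (hc α)).hom_ext fun j => by
        have h₁ := (hc α).fac ((evalF D α).mapCocone s) j
        have h₂ := (hc β).fac ((evalF D β).mapCocone s) j
        have h₃ := (c.ι.app j).comm h
        have h₄ := (s.ι.app j).comm h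
        dsimp [evalF] at h₁ h₂ h₃ h₄ ⊢
        rw [← Functor.map_comp_assoc, h₁, h₄, reassoc_of% h₃, h₂] }
  fac s j := ConfHom.ext (funext fun β => (hc β).fac ((evalF D β).mapCocone s) j)
  uniq s m hm := ConfHom.ext (funext fun β =>
    (hc β).uniq ((evalF D β).mapCocone s) (m.f β) fun j => congr_arg (fun u => u.f β) (hm j))

/-- Limits in `M(S,C)` are detected componentwise. -/
def isLimitOfEval (c : Cone K) (hc : ∀ β, IsLimit ((evalF D β).mapCone c)) : IsLimit c where
  lift s :=
    { f := fun β => (hc β).lift ((evalF D β).mapCone s)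
      comm := fun {α β} h => (hc β).hom_ext fun j => by
        have h₁ := (hc α).fac ((evalF D α).mapCone s) j
        have h₂ := (hc β).fac ((evalF D β).mapCone s) j
        have h₃ := (c.π.app j).comm h
        have h₄ := (s.π.app j).comm h
        dsimp [evalF] at h₁ h₂ h₃ h₄ ⊢
        rw [Category.assoc, Category.assoc, h₂, ← h₃, ← Functor.map_comp_assoc, h₁, h₄] }
  fac s j := ConfHom.ext (funext fun β => (hc β).fac ((evalF D β).mapCone s) j)
  uniq s m hm := ConfHom.ext (funext fun β =>
    (hc β).uniq ((evalF D β).mapCone s) (m.f β) fun j => congr_arg (fun u => u.f β) (hm j))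

end Exactness

lemma preservesFiniteColimits_of_eval {D : PosetDiagram.{v, u} S}
    [∀ {α β : S} (h : β ≤ α), PreservesFiniteColimits (D.φ h)] {A : Type*} [Category* A]
    (G : A ⥤ ConfObj D) (hG : ∀ β, PreservesFiniteColimits (G ⋙ evalF D β)) :
    PreservesFiniteColimits G :=
  ⟨fun _ _ _ => ⟨fun {_} => ⟨fun hc =>
    ⟨isColimitOfEval _ fun β => isColimitOfPreserves (G ⋙ evalF D β) hc⟩⟩⟩⟩

lemma preservesFiniteLimits_of_eval {D : PosetDiagram.{v, u} S} {A : Type*} [Category* A]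
    (G : A ⥤ ConfObj D) (hG : ∀ β, PreservesFiniteLimits (G ⋙ evalF D β)) :
    PreservesFiniteLimits G :=
  ⟨fun _ _ _ => ⟨fun {_} => ⟨fun hc =>
    ⟨isLimitOfEval _ fun β => isLimitOfPreserves (G ⋙ evalF D β) hc⟩⟩⟩⟩

section

variable {D}
variable {J : Type} [SmallCategory J] [FinCategory J] [∀ α, Abelian (D.C α)]

/-- The componentwise limit. -/
noncomputable def limitCone (K : J ⥤ ConfObj D) : Cone K :=
  let s := fun {α β : S} (h : β ≤ α) =>
    ({ pt := (D.φ h).obj (limit (K ⋙ evalF D α))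
       π :=
        { app := fun j => (D.φ h).map (limit.π (K ⋙ evalF D α) j) ≫ (K.obj j).σ h
          naturality := fun i j f => by
            have h₁ := (K.map f).comm h
            have h₂ := limit.w (K ⋙ evalF D α) f
            dsimp [evalF] at h₁ h₂ ⊢
            rw [Category.id_comp, Category.assoc, ← h₁, ← Functor.map_comp_assoc, h₂] } } :
      Cone (K ⋙ evalF D β))
  { pt := ConfObj.ofJointlyMono D K.obj (fun β => limit (K ⋙ evalF D β))
      (fun j β => limit.π (K ⋙ evalF D β) j) (fun h => limit.hom_ext h)
      (fun {α β} h => limit.lift (K ⋙ evalF D β) (s h)) (fun h j => limit.lift_π (s h) j)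
    π :=
      { app := fun j =>
          { f := fun β => limit.π (K ⋙ evalF D β) j
            comm := fun h => (limit.lift_π (s h) j).symm }
        naturality := fun i j f => ConfHom.ext (funext fun β =>
          (Category.id_comp _).trans (limit.w (K ⋙ evalF D β) f).symm) } }

noncomputable def isLimitMapConeLimitCone (K : J ⥤ ConfObj D) (β : S) :
    IsLimit ((evalF D β).mapCone (limitCone K)) :=
  (limit.isLimit (K ⋙ evalF D β)).ofIsoLimit
    (Cone.ext (Iso.refl _) fun _ => (Category.id_comp _).symm)

instance (β : S) : PreservesFiniteLimits (evalF D β) where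
  preservesFiniteLimits _ _ _ := ⟨fun {K} =>
    preservesLimit_of_preserves_limit_cone
      (isLimitOfEval (limitCone K) (isLimitMapConeLimitCone K)) (isLimitMapConeLimitCone K β)⟩

variable [∀ {α β : S} (h : β ≤ α), PreservesFiniteColimits (D.φ h)]

/-- The componentwise colimit. -/
noncomputable def colimitCocone (K : J ⥤ ConfObj D) : Cocone K :=
  let hc := fun {α β : S} (h : β ≤ α) =>
    isColimitOfPreserves (D.φ h) (colimit.isColimit (K ⋙ evalF D α))
  let s := fun {α β : S} (h : β ≤ α) =>
    ({ pt := colimit (K ⋙ evalF D β)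
       ι :=
        { app := fun j => (K.obj j).σ h ≫ colimit.ι (K ⋙ evalF D β) j
          naturality := fun i j f => by
            have h₁ := (K.map f).comm h
            have h₂ := colimit.w (K ⋙ evalF D β) f
            dsimp [evalF] at h₁ h₂ ⊢
            rw [Category.comp_id, reassoc_of% h₁, h₂] } } :
      Cocone ((K ⋙ evalF D α) ⋙ D.φ h))
  { pt := ConfObj.ofJointlyEpi D K.obj (fun β => colimit (K ⋙ evalF D β))
      (fun j β => colimit.ι (K ⋙ evalF D β) j) (fun h _ _ _ => (hc h).hom_ext)
      (fun {α β} h => (hc h).desc (s h)) (fun h j => (hc h).fac (s h) j)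
    ι :=
      { app := fun j =>
          { f := fun β => colimit.ι (K ⋙ evalF D β) j
            comm := fun h => (hc h).fac (s h) j }
        naturality := fun i j f => ConfHom.ext (funext fun β =>
          (colimit.w (K ⋙ evalF D β) f).trans (Category.comp_id _).symm) } }

noncomputable def isColimitMapCoconeColimitCocone (K : J ⥤ ConfObj D) (β : S) :
    IsColimit ((evalF D β).mapCocone (colimitCocone K)) :=
  (colimit.isColimit (K ⋙ evalF D β)).ofIsoColimit
    (Cocone.ext (Iso.refl _) fun _ => Category.comp_id _)

instance (β : S) : PreservesFiniteColimits (evalF D β) where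
  preservesFiniteColimits _ _ _ := ⟨fun {K} =>
    preservesColimit_of_preserves_colimit_cocone
      (isColimitOfEval (colimitCocone K) (isColimitMapCoconeColimitCocone K))
      (isColimitMapCoconeColimitCocone K β)⟩

end

section

variable {D} [∀ α, Abelian (D.C α)]

lemma isZero_φ_obj [∀ {α β : S} (h : β ≤ α), PreservesFiniteColimits (D.φ h)] {α β : S}
    (h : β ≤ α) {X : D.C α} (hX : IsZero X) : IsZero ((D.φ h).obj X) :=
  (D.φ h).map_isZero hX

/-- The object `X` if the proposition `P` holds, and the zero object otherwise. -/
noncomputable def objOrZero {C : Type u} [Category.{v} C] [HasZeroObject C] (P : Prop)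
    (X : P → C) : C :=
  open scoped Classical ZeroObject in if h : P then X h else 0

noncomputable def objOrZeroIso {C : Type u} [Category.{v} C] [HasZeroObject C] {P : Prop}
    (X : P → C) (h : P) : objOrZero P X ≅ X h :=
  eqToIso (dif_pos h)

lemma isZero_objOrZero {C : Type u} [Category.{v} C] [HasZeroObject C] {P : Prop}
    (X : P → C) (h : ¬ P) : IsZero (objOrZero P X) :=
  (isZero_zero C).of_iso (eqToIso (dif_neg h))

open Classical in
/-- The morphism `f` if the proposition `P` holds, and zero otherwise. -/
noncomputable def mapOrZero {C : Type u} [Category.{v} C] [HasZeroObject C]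
    [HasZeroMorphisms C] {P : Prop} {X Y : P → C} (f : ∀ h : P, X h ⟶ Y h) :
    objOrZero P X ⟶ objOrZero P Y :=
  if h : P then (objOrZeroIso X h).hom ≫ f h ≫ (objOrZeroIso Y h).inv else 0

lemma mapOrZero_eq {C : Type u} [Category.{v} C] [HasZeroObject C]
    [HasZeroMorphisms C] {P : Prop} {X Y : P → C} (f : ∀ h : P, X h ⟶ Y h) (h : P) :
    mapOrZero f = (objOrZeroIso X h).hom ≫ f h ≫ (objOrZeroIso Y h).inv :=
  dif_pos h

lemma objOrZeroIso_inv_mapOrZero {C : Type u} [Category.{v} C] [HasZeroObject C]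
    [HasZeroMorphisms C] {P : Prop} {X Y : P → C} (f : ∀ h : P, X h ⟶ Y h) (h : P) :
    (objOrZeroIso X h).inv ≫ mapOrZero f = f h ≫ (objOrZeroIso Y h).inv := by
  simp [mapOrZero_eq f h]

lemma mapOrZero_id {C : Type u} [Category.{v} C] [HasZeroObject C]
    [HasZeroMorphisms C] {P : Prop} (X : P → C) : mapOrZero (fun h => 𝟙 (X h)) = 𝟙 _ := by
  by_cases h : P
  · simp [mapOrZero_eq _ h]
  · exact (isZero_objOrZero _ h).eq_of_src _ _

lemma mapOrZero_comp {C : Type u} [Category.{v} C] [HasZeroObject C]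
    [HasZeroMorphisms C] {P : Prop} {X Y Z : P → C} (f : ∀ h : P, X h ⟶ Y h)
    (g : ∀ h : P, Y h ⟶ Z h) :
    mapOrZero (fun h => f h ≫ g h) = mapOrZero f ≫ mapOrZero g := by
  by_cases h : P
  · simp [mapOrZero_eq _ h]
  · exact (isZero_objOrZero _ h).eq_of_src _ _

open Classical in
/-- The morphism from `objOrZero P X` induced by morphisms from `X`. -/
noncomputable def descOrZero {C : Type u} [Category.{v} C] [HasZeroObject C]
    [HasZeroMorphisms C] {P : Prop} {X : P → C} {Y : C} (f : ∀ h : P, X h ⟶ Y) :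
    objOrZero P X ⟶ Y :=
  if h : P then (objOrZeroIso X h).hom ≫ f h else 0

lemma descOrZero_eq {C : Type u} [Category.{v} C] [HasZeroObject C]
    [HasZeroMorphisms C] {P : Prop} {X : P → C} {Y : C} (f : ∀ h : P, X h ⟶ Y) (h : P) :
    descOrZero f = (objOrZeroIso X h).hom ≫ f h :=
  dif_pos h

lemma objOrZeroIso_inv_descOrZero {C : Type u} [Category.{v} C] [HasZeroObject C]
    [HasZeroMorphisms C] {P : Prop} {X : P → C} {Y : C} (f : ∀ h : P, X h ⟶ Y) (h : P) :
    (objOrZeroIso X h).inv ≫ descOrZero f = f h := by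
  simp [descOrZero_eq f h]

lemma descOrZero_objOrZeroIso_inv_comp {C : Type u} [Category.{v} C] [HasZeroObject C]
    [HasZeroMorphisms C] {P : Prop} {X : P → C} {Y : C} (f : objOrZero P X ⟶ Y) :
    descOrZero (fun h => (objOrZeroIso X h).inv ≫ f) = f := by
  by_cases h : P
  · simp [descOrZero_eq _ h]
  · exact (isZero_objOrZero _ h).eq_of_src _ _

lemma descOrZero_comp_left {C : Type u} [Category.{v} C] [HasZeroObject C]
    [HasZeroMorphisms C] {P : Prop} {X X' : P → C} {Y : C} (f : ∀ h : P, X h ⟶ X' h)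
    (g : ∀ h : P, X' h ⟶ Y) :
    descOrZero (fun h => f h ≫ g h) = mapOrZero f ≫ descOrZero g := by
  by_cases h : P
  · simp [descOrZero_eq _ h, mapOrZero_eq _ h]
  · exact (isZero_objOrZero _ h).eq_of_src _ _

end

section ExtensionByZero

variable {D} [∀ α, Abelian (D.C α)] {T : Set S}

section

variable {X : ∀ β, β ∈ T → D.C β}
  (s : ∀ {α β : S} (h : β ≤ α) (hα : α ∈ T) (hβ : β ∈ T), (D.φ h).obj (X α hα) ⟶ X β hβ)

open Classical in
/-- The extension by zero of a family of structure maps defined on a subset. -/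
noncomputable def extZeroσ {α β : S} (h : β ≤ α) :
    (D.φ h).obj (objOrZero (α ∈ T) (X α)) ⟶ objOrZero (β ∈ T) (X β) :=
  if hT : α ∈ T ∧ β ∈ T then
    (D.φ h).map (objOrZeroIso (X α) hT.1).hom ≫ s h hT.1 hT.2 ≫ (objOrZeroIso (X β) hT.2).inv
  else 0

lemma extZeroσ_eq {α β : S} (h : β ≤ α) (hα : α ∈ T) (hβ : β ∈ T) :
    extZeroσ s h =
      (D.φ h).map (objOrZeroIso (X α) hα).hom ≫ s h hα hβ ≫ (objOrZeroIso (X β) hβ).inv :=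
  dif_pos ⟨hα, hβ⟩

lemma map_objOrZeroIso_inv_extZeroσ {α β : S} (h : β ≤ α) (hα : α ∈ T) (hβ : β ∈ T) :
    (D.φ h).map (objOrZeroIso (X α) hα).inv ≫ extZeroσ s h =
      s h hα hβ ≫ (objOrZeroIso (X β) hβ).inv := by
  rw [extZeroσ_eq s h hα hβ, ← Functor.map_comp_assoc]
  simp

lemma map_objOrZeroIso_inv_extZeroσ_assoc {α β : S} (h : β ≤ α) (hα : α ∈ T) (hβ : β ∈ T)
    {Z : D.C β} (f : objOrZero (β ∈ T) (X β) ⟶ Z) :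
    (D.φ h).map (objOrZeroIso (X α) hα).inv ≫ extZeroσ s h ≫ f =
      s h hα hβ ≫ (objOrZeroIso (X β) hβ).inv ≫ f := by
  rw [← Category.assoc, map_objOrZeroIso_inv_extZeroσ s h hα hβ, Category.assoc]

lemma extZeroσ_refl (hs : ∀ α (hα : α ∈ T), s (le_refl α) hα hα =
      eqToHom (by rw [D.φ_refl]; rfl)) (α : S) :
    extZeroσ s (le_refl α) = eqToHom (by rw [D.φ_refl]; rfl) := by
  by_cases hα : α ∈ T
  · rw [extZeroσ_eq s _ hα hα, D.φ_refl_map, hs]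
    simp
  · exact (isZero_objOrZero _ hα).eq_of_tgt _ _

lemma extZeroσ_trans [hT : T.OrdConnected]
    [∀ {α β : S} (h : β ≤ α), PreservesFiniteColimits (D.φ h)]
    (hs : ∀ {α β γ : S} (h₁ : β ≤ α) (h₂ : γ ≤ β) (hα : α ∈ T) (hβ : β ∈ T) (hγ : γ ∈ T),
      s (h₂.trans h₁) hα hγ = eqToHom (by rw [D.φ_trans h₁ h₂]; rfl) ≫
        (D.φ h₂).map (s h₁ hα hβ) ≫ s h₂ hβ hγ)
    {α β γ : S} (h₁ : β ≤ α) (h₂ : γ ≤ β) :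
    extZeroσ s (h₂.trans h₁) = eqToHom (by rw [D.φ_trans h₁ h₂]; rfl) ≫
      (D.φ h₂).map (extZeroσ s h₁) ≫ extZeroσ s h₂ := by
  by_cases hα : α ∈ T
  · by_cases hγ : γ ∈ T
    · have hβ : β ∈ T := hT.out hγ hα ⟨h₂, h₁⟩
      rw [extZeroσ_eq s _ hα hγ, extZeroσ_eq s _ hα hβ, extZeroσ_eq s _ hβ hγ, hs h₁ h₂ hα hβ hγ,
        D.φ_trans_map h₁ h₂]
      simp only [Functor.map_comp, Category.assoc, eqToHom_trans_assoc, eqToHom_refl,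
        Category.id_comp]
      rw [← (D.φ h₂).map_comp_assoc (objOrZeroIso (X β) hβ).inv]
      simp
    · exact (isZero_objOrZero _ hγ).eq_of_tgt _ _
  · exact (isZero_φ_obj _ (isZero_objOrZero _ hα)).eq_of_src _ _

lemma extZeroσ_naturality [∀ {α β : S} (h : β ≤ α), PreservesFiniteColimits (D.φ h)]
    {Y : ∀ β, β ∈ T → D.C β}
    (t : ∀ {α β : S} (h : β ≤ α) (hα : α ∈ T) (hβ : β ∈ T), (D.φ h).obj (Y α hα) ⟶ Y β hβ)
    (f : ∀ β (hβ : β ∈ T), X β hβ ⟶ Y β hβ)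
    (hf : ∀ {α β : S} (h : β ≤ α) (hα : α ∈ T) (hβ : β ∈ T),
      (D.φ h).map (f α hα) ≫ t h hα hβ = s h hα hβ ≫ f β hβ) {α β : S} (h : β ≤ α) :
    (D.φ h).map (mapOrZero (f α)) ≫ extZeroσ t h = extZeroσ s h ≫ mapOrZero (f β) := by
  by_cases hα : α ∈ T
  · by_cases hβ : β ∈ T
    · rw [extZeroσ_eq s h hα hβ, mapOrZero_eq _ hα, mapOrZero_eq _ hβ, Functor.map_comp,
        Functor.map_comp, Category.assoc, Category.assoc,
        map_objOrZeroIso_inv_extZeroσ t h hα hβ, reassoc_of% hf h hα hβ]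
      simp
    · exact (isZero_objOrZero _ hβ).eq_of_tgt _ _
  · exact (isZero_φ_obj _ (isZero_objOrZero _ hα)).eq_of_src _ _

lemma descOrZero_naturality [∀ {α β : S} (h : β ≤ α), PreservesFiniteColimits (D.φ h)]
    (hT : IsLowerSet T) (G : ConfObj D) (f : ∀ β (hβ : β ∈ T), X β hβ ⟶ G.F β)
    (hf : ∀ {α β : S} (h : β ≤ α) (hα : α ∈ T) (hβ : β ∈ T),
      (D.φ h).map (f α hα) ≫ G.σ h = s h hα hβ ≫ f β hβ) {α β : S} (h : β ≤ α) :
    (D.φ h).map (descOrZero (f α)) ≫ G.σ h = extZeroσ s h ≫ descOrZero (f β) := by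
  by_cases hα : α ∈ T
  · have hβ : β ∈ T := hT h hα
    rw [extZeroσ_eq s h hα hβ, descOrZero_eq _ hα, descOrZero_eq _ hβ, Functor.map_comp,
      Category.assoc, hf h hα hβ]
    simp
  · exact (isZero_φ_obj _ (isZero_objOrZero _ hα)).eq_of_src _ _

lemma map_objOrZeroIso_inv_comp (G : ConfObj D) (u : ∀ β, objOrZero (β ∈ T) (X β) ⟶ G.F β)
    (hu : ∀ {α β : S} (h : β ≤ α), (D.φ h).map (u α) ≫ G.σ h = extZeroσ s h ≫ u β)
    {α β : S} (h : β ≤ α) (hα : α ∈ T) (hβ : β ∈ T) :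
    (D.φ h).map ((objOrZeroIso (X α) hα).inv ≫ u α) ≫ G.σ h =
      s h hα hβ ≫ (objOrZeroIso (X β) hβ).inv ≫ u β := by
  rw [Functor.map_comp, Category.assoc, hu h, map_objOrZeroIso_inv_extZeroσ_assoc s h hα hβ]

end

/-- The component of `F : M(T,C|_T)` at `β ∈ T`. -/
abbrev partialObj (F : ConfObj (D.restrict T)) (β : S) (hβ : β ∈ T) : D.C β := F.F ⟨β, hβ⟩

/-- The structure maps of `F : M(T,C|_T)`. -/
abbrev partialσ (F : ConfObj (D.restrict T)) {α β : S} (h : β ≤ α) (hα : α ∈ T) (hβ : β ∈ T) :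
    (D.φ h).obj (partialObj F α hα) ⟶ partialObj F β hβ :=
  F.σ (α := ⟨α, hα⟩) (β := ⟨β, hβ⟩) h

variable [∀ {α β : S} (h : β ≤ α), PreservesFiniteColimits (D.φ h)]

/-- The extension by zero of an object of `M(T,C|_T)`, for `T` locally closed. -/
noncomputable def extZeroObj [T.OrdConnected] (F : ConfObj (D.restrict T)) : ConfObj D where
  F β := objOrZero (β ∈ T) (partialObj F β)
  σ := extZeroσ (partialσ F)
  σ_refl := extZeroσ_refl _ fun α hα => F.σ_refl ⟨α, hα⟩
  σ_trans := extZeroσ_trans _ fun {α β γ} h₁ h₂ hα hβ hγ =>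
    F.σ_trans (α := ⟨α, hα⟩) (β := ⟨β, hβ⟩) (γ := ⟨γ, hγ⟩) h₁ h₂

variable (D T)

/-- The extension by zero from a locally closed subset. -/
noncomputable def extZero [T.OrdConnected] : ConfObj (D.restrict T) ⥤ ConfObj D where
  obj := extZeroObj
  map {F G} u :=
    { f := fun β => mapOrZero (X := partialObj F β) (Y := partialObj G β) fun hβ => u.f ⟨β, hβ⟩
      comm := extZeroσ_naturality (partialσ F) (partialσ G) (fun β hβ => u.f ⟨β, hβ⟩)
        fun {α β} h hα hβ => u.comm (α := ⟨α, hα⟩) (β := ⟨β, hβ⟩) h }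
  map_id F := ConfHom.ext (funext fun β => mapOrZero_id (partialObj F β))
  map_comp {F G H} u v := ConfHom.ext (funext fun β =>
    mapOrZero_comp (X := partialObj F β) (Y := partialObj G β) (Z := partialObj H β)
      (fun hβ => u.f ⟨β, hβ⟩) fun hβ => v.f ⟨β, hβ⟩)

/-- The components of the extension by zero at points of the subset. -/
noncomputable def extZeroCompEvalIso [T.OrdConnected] {β : S} (hβ : β ∈ T) :
    extZero D T ⋙ evalF D β ≅ (evalF (D.restrict T) ⟨β, hβ⟩ : ConfObj (D.restrict T) ⥤ D.C β) :=
  NatIso.ofComponents (fun F => objOrZeroIso (partialObj F β) hβ) fun {F G} u => by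
    refine (congr_arg (· ≫ _) (mapOrZero_eq (X := partialObj F β) (Y := partialObj G β)
      (fun hβ => u.f ⟨β, hβ⟩) hβ)).trans ?_
    refine (Category.assoc _ _ _).trans (congr_arg (_ ≫ ·) ((Category.assoc _ _ _).trans ?_))
    exact (congr_arg (_ ≫ ·) (Iso.inv_hom_id _)).trans (Category.comp_id _)

lemma isZero_extZero_comp_eval [T.OrdConnected] {β : S} (hβ : β ∉ T) :
    IsZero (extZero D T ⋙ evalF D β) :=
  (Functor.isZero_iff _).2 fun _ => isZero_objOrZero _ hβ

instance [T.OrdConnected] : PreservesFiniteLimits (extZero D T) :=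
  preservesFiniteLimits_of_eval _ fun β => by
    by_cases hβ : β ∈ T
    · have : PreservesFiniteLimits
          (evalF (D.restrict T) ⟨β, hβ⟩ : ConfObj (D.restrict T) ⥤ D.C β) :=
        inferInstanceAs (PreservesFiniteLimits (evalF (D.restrict T) ⟨β, hβ⟩))
      exact @preservesFiniteLimits_of_natIso _ _ _ _ _ _ (extZeroCompEvalIso D T hβ).symm this
    · exact ⟨fun _ _ _ =>
        Functor.preservesLimitsOfShape_of_isZero _ (isZero_extZero_comp_eval D T hβ) _⟩

instance [T.OrdConnected] : PreservesFiniteColimits (extZero D T) :=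
  preservesFiniteColimits_of_eval _ fun β => by
    by_cases hβ : β ∈ T
    · have : PreservesFiniteColimits
          (evalF (D.restrict T) ⟨β, hβ⟩ : ConfObj (D.restrict T) ⥤ D.C β) :=
        inferInstanceAs (PreservesFiniteColimits (evalF (D.restrict T) ⟨β, hβ⟩))
      exact @preservesFiniteColimits_of_natIso _ _ _ _ _ _ (extZeroCompEvalIso D T hβ).symm this
    · exact ⟨fun _ _ _ =>
        Functor.preservesColimitsOfShape_of_isZero _ (isZero_extZero_comp_eval D T hβ) _⟩

instance : PreservesFiniteLimits (resF D T) :=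
  preservesFiniteLimits_of_eval _ fun β =>
    inferInstanceAs (PreservesFiniteLimits (evalF D β.1))

instance : PreservesFiniteColimits (resF D T) :=
  preservesFiniteColimits_of_eval _ fun β =>
    inferInstanceAs (PreservesFiniteColimits (evalF D β.1))

/-- Extension by zero from an open subset is left adjoint to restriction. -/
noncomputable def extZeroAdjunction [T.OrdConnected] (hT : IsLowerSet T) :
    extZero D T ⊣ resF D T :=
  Adjunction.mkOfHomEquiv
    { homEquiv := fun F G =>
        { toFun := fun u =>
            { f := fun t => (objOrZeroIso (partialObj F t.1) t.2).inv ≫ u.f t.1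
              comm := fun {α β} h => map_objOrZeroIso_inv_comp (partialσ F) G u.f
                (fun {_ _} h => u.comm h) h α.2 β.2 }
          invFun := fun v =>
            { f := fun β => descOrZero (X := partialObj F β) fun hβ => v.f ⟨β, hβ⟩
              comm := descOrZero_naturality (partialσ F) hT G (fun β hβ => v.f ⟨β, hβ⟩)
                fun {α β} h hα hβ => v.comm (α := ⟨α, hα⟩) (β := ⟨β, hβ⟩) h }
          left_inv := fun u => ConfHom.ext (funext fun β => descOrZero_objOrZeroIso_inv_comp (u.f β))
          right_inv := fun v => ConfHom.ext (funext fun β =>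
            objOrZeroIso_inv_descOrZero (X := partialObj F β.1) (Y := G.F β.1) (fun hβ => v.f ⟨β.1, hβ⟩) β.2) }
      homEquiv_naturality_left_symm := fun {F F' G} u v => ConfHom.ext (funext fun β =>
        descOrZero_comp_left (X := partialObj F β) (X' := partialObj F' β)
          (Y := G.F β) (fun hβ => u.f ⟨β, hβ⟩) fun hβ => v.f ⟨β, hβ⟩)
      homEquiv_naturality_right := fun {F _ _} u v => ConfHom.ext (funext fun β =>
        (Category.assoc (objOrZeroIso (partialObj F β.1) β.2).inv (u.f β.1) (v.f β.1)).symm) }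

/-- Extension by zero from an open subset is a section of restriction. -/
noncomputable def extZeroCompResIso [T.OrdConnected] : extZero D T ⋙ resF D T ≅ 𝟭 _ :=
  (NatIso.ofComponents (F := 𝟭 _) (G := extZero D T ⋙ resF D T)
    (fun F => ConfObj.isoMk (fun t => (objOrZeroIso (partialObj F t.1) t.2).symm)
      fun {α β} h => map_objOrZeroIso_inv_extZeroσ (partialσ F) h α.2 β.2)
    fun {F G} u => ConfHom.ext (funext fun t => (objOrZeroIso_inv_mapOrZero
      (X := partialObj F t.1) (Y := partialObj G t.1) (fun ht => u.f ⟨t.1, ht⟩) t.2).symm)).symm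

end ExtensionByZero

section TopElement

variable {D}

/-- The morphism to an object supported at the greatest element of the poset which is determined
by its component at that element. -/
noncomputable def homOfSuppInTop [∀ α, Abelian (D.C α)] {t : S} (ht : ∀ β, β ≤ t)
    {F G : ConfObj D} (hG : SuppIn G {t}) (g : F.F t ⟶ G.F t) : F ⟶ G where
  f := open scoped Classical in Function.update (fun β => 0) t g
  comm := fun {α β} h => by
    by_cases hβ : β = t
    · subst hβ
      obtain rfl := le_antisymm h (ht α)
      rw [D.φ_refl_map, F.σ_refl, G.σ_refl]
      simp
    · exact (hG β hβ).eq_of_tgt _ _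

lemma homOfSuppInTop_f [∀ α, Abelian (D.C α)] {t : S} (ht : ∀ β, β ≤ t)
    {F G : ConfObj D} (hG : SuppIn G {t}) (g : F.F t ⟶ G.F t) :
    (homOfSuppInTop ht hG g).f t = g := by
  simp [homOfSuppInTop]

lemma ConfHom.ext_of_suppIn {F G : ConfObj D} {t : S} (hG : SuppIn G {t}) {u v : F ⟶ G}
    (h : u.f t = v.f t) : u = v :=
  ConfHom.ext (funext fun β => by
    by_cases hβ : β = t
    · subst hβ
      exact h
    · exact (hG β hβ).eq_of_tgt _ _)

/-- A section of the evaluation at the greatest element of the poset which is supported at that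
element is right adjoint to the evaluation. -/
noncomputable def evalAdjunction [∀ α, Abelian (D.C α)] {t : S} (ht : ∀ β, β ≤ t)
    (G : D.C t ⥤ ConfObj D) (e : G ⋙ evalF D t ≅ 𝟭 _)
    (hG : ∀ X, SuppIn (G.obj X) {t}) : evalF D t ⊣ G :=
  Adjunction.mkOfHomEquiv
    { homEquiv := fun _ X =>
        { toFun := fun g => homOfSuppInTop ht (hG X) (g ≫ e.inv.app X)
          invFun := fun u => u.f t ≫ e.hom.app X
          left_inv := fun g => (congr_arg (· ≫ e.hom.app X)
            (homOfSuppInTop_f ht (hG X) (g ≫ e.inv.app X))).trans <|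
              (Category.assoc _ _ _).trans <|
                (congr_arg (g ≫ ·) (e.inv_hom_id_app X)).trans (Category.comp_id _)
          right_inv := fun u => ConfHom.ext_of_suppIn (hG X)
            ((homOfSuppInTop_f ht (hG X) _).trans ((Category.assoc _ _ _).trans
              ((congr_arg (u.f t ≫ ·) (e.hom_inv_id_app X)).trans (Category.comp_id _)))) }
      homEquiv_naturality_left_symm := fun _ _ => Category.assoc _ _ _
      homEquiv_naturality_right := fun {_ X Y} f g => ConfHom.ext_of_suppIn (hG Y)
        ((homOfSuppInTop_f ht (hG Y) _).trans <| (Category.assoc _ _ _).trans <|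
          (congr_arg (f ≫ ·) (e.inv.naturality g)).trans <| (Category.assoc _ _ _).symm.trans <|
            (congr_arg (· ≫ (G.map g).f t) (homOfSuppInTop_f ht (hG X) _)).symm) }

lemma eqToHom_φ_trans {α β γ δ : S} (h₁ : β ≤ α) (h₂ : γ ≤ β) (h₃ : δ ≤ γ) (X : D.C α) :
    (eqToHom (Functor.congr_obj (D.φ_trans h₁ (h₃.trans h₂)) X).symm :
        (D.φ (h₃.trans h₂)).obj ((D.φ h₁).obj X) ⟶ (D.φ ((h₃.trans h₂).trans h₁)).obj X) =
      eqToHom (by rw [D.φ_trans h₂ h₃]; rfl) ≫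
        (D.φ h₃).map (eqToHom (Functor.congr_obj (D.φ_trans h₁ h₂) X).symm) ≫
          eqToHom (Functor.congr_obj (D.φ_trans (h₂.trans h₁) h₃) X).symm := by
  rw [eqToHom_map, eqToHom_trans, eqToHom_trans]

lemma φ_map_eqToHom {α β γ : S} (h₁ : β ≤ α) (h₂ : γ ≤ β) {X Y : D.C α} (f : X ⟶ Y) :
    (D.φ h₂).map ((D.φ h₁).map f) ≫ eqToHom (Functor.congr_obj (D.φ_trans h₁ h₂) Y).symm =
      eqToHom (Functor.congr_obj (D.φ_trans h₁ h₂) X).symm ≫ (D.φ (h₂.trans h₁)).map f := by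
  rw [D.φ_trans_map h₁ h₂]
  simp

variable (D) in
/-- The left adjoint of the evaluation at the greatest element of `U_α`. -/
def freeTop (α : S) : D.C α ⥤ ConfObj (D.restrict (Set.Iic α)) where
  obj X :=
    { F := fun β => (D.φ β.2).obj X
      σ := fun {β _} h => eqToHom (Functor.congr_obj (D.φ_trans β.2 h) X).symm
      σ_refl := fun _ => rfl
      σ_trans := fun {β _ _} h₁ h₂ => eqToHom_φ_trans (D := D) β.2 h₁ h₂ X }
  map f :=
    { f := fun β => (D.φ β.2).map f
      comm := fun {β _} h => φ_map_eqToHom (D := D) β.2 h f }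
  map_id X := ConfHom.ext (funext fun β => (D.φ β.2).map_id X)
  map_comp f g := ConfHom.ext (funext fun β => (D.φ β.2).map_comp f g)

variable [∀ α, Abelian (D.C α)] [∀ {α β : S} (h : β ≤ α), PreservesFiniteColimits (D.φ h)]
  (α : S)

variable (D)

/-- The greatest element of `U_α`. -/
abbrev topIic (α : S) : Set.Iic α := ⟨α, le_refl α⟩

/-- The evaluation at the greatest element of `U_α`. -/
def evalAtTop : ConfObj (D.restrict (Set.Iic α)) ⥤ D.C α :=
  evalF (D.restrict (Set.Iic α)) (topIic α)

/-- The extension by zero from the closed point of `U_α`. -/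
noncomputable def skyscraper : D.C α ⥤ ConfObj (D.restrict (Set.Iic α)) :=
  freeTop D α ⋙ resF (D.restrict (Set.Iic α)) {topIic α} ⋙
    extZero (D.restrict (Set.Iic α)) {topIic α}

/-- The evaluation at the closed point of `U_α` is a retraction of the extension by zero. -/
noncomputable def skyscraperCompEvalIso : skyscraper D α ⋙ evalAtTop D α ≅ 𝟭 _ :=
  Iso.trans (Y := D.φ (le_refl α))
    (Functor.isoWhiskerLeft (freeTop D α ⋙ resF (D.restrict (Set.Iic α)) {topIic α})
      (extZeroCompEvalIso (D.restrict (Set.Iic α)) {topIic α} rfl))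
    (eqToIso (D.φ_refl α))

lemma suppIn_skyscraper (X : D.C α) : SuppIn ((skyscraper D α).obj X) {topIic α} :=
  fun β h => isZero_objOrZero
    (partialObj ((resF _ {topIic α}).obj ((freeTop D α).obj X)) β) h

/-- The extension by zero from the closed point of `U_α` is right adjoint to the evaluation. -/
noncomputable def skyscraperAdjunction : evalAtTop D α ⊣ skyscraper D α :=
  evalAdjunction (D := D.restrict (Set.Iic α)) (t := topIic α) (fun β => β.2)
    (skyscraper D α) (skyscraperCompEvalIso D α) (suppIn_skyscraper D α)

lemma isZero_skyscraper_comp_eval {β : Set.Iic α} (hβ : β ≠ topIic α) :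
    IsZero (skyscraper D α ⋙ evalF (D.restrict (Set.Iic α)) β) :=
  (Functor.isZero_iff _).2 fun X => suppIn_skyscraper D α X β hβ

lemma preservesFiniteLimits_skyscraper : PreservesFiniteLimits (skyscraper D α) :=
  preservesFiniteLimits_of_eval _ fun β => by
    by_cases hβ : β = topIic α
    · subst hβ
      have : PreservesFiniteLimits (skyscraper D α ⋙ evalAtTop D α) :=
        preservesFiniteLimits_of_natIso (skyscraperCompEvalIso D α).symm
      exact this
    · exact ⟨fun _ _ _ =>
        Functor.preservesLimitsOfShape_of_isZero _ (isZero_skyscraper_comp_eval D α hβ) _⟩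

lemma preservesFiniteColimits_skyscraper : PreservesFiniteColimits (skyscraper D α) :=
  preservesFiniteColimits_of_eval _ fun β => by
    by_cases hβ : β = topIic α
    · subst hβ
      have : PreservesFiniteColimits (skyscraper D α ⋙ evalAtTop D α) :=
        preservesFiniteColimits_of_natIso (skyscraperCompEvalIso D α).symm
      exact this
    · exact ⟨fun _ _ _ =>
        Functor.preservesColimitsOfShape_of_isZero _ (isZero_skyscraper_comp_eval D α hβ) _⟩

end TopElement

end ConfigurationCategory

/-- Corollary 2.13: let `M(S,C)` be a configuration category in which every
`C(β)` has enough injectives, and fix `α ∈ S`.  Let `i : {α} ↪ U_α` be the closed embedding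
(so that `i_* : C(α) ⥤ M(U_α, C|_{U_α})` is the right adjoint of the evaluation `i^*` at `α`)
and `j : U_α ↪ S` the open embedding (so that `j_! : M(U_α, C|_{U_α}) ⥤ M(S,C)` is the left
adjoint of the restriction `j^*`).  Then the composition `j_! ∘ i_*` induces a fully faithful
functor `D^b(C(α)) ⥤ D^b(M(S,C))`; in particular `D^b(C(α))` is naturally a full
subcategory of `D^b(M(S,C))`. -/
theorem derived_category_of_stratum_fully_faithful
    (S : Type) [PartialOrder S] [Fintype S]
    (D : PosetDiagram.{v, u} S) [∀ α : S, Abelian (D.C α)]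
    (hφ : ∀ {α β : S} (h : β ≤ α), PreservesFiniteColimits (D.φ h))
    (ψ : ∀ {α β : S}, β ≤ α → (D.C β ⥤ D.C α))
    (adj : ∀ {α β : S} (h : β ≤ α), D.φ h ⊣ ψ h)
    (ψlex : ∀ {α β : S} (h : β ≤ α), PreservesFiniteLimits (ψ h))
    (ψrex : ∀ {α β : S} (h : β ≤ α), PreservesFiniteColimits (ψ h))
    (hinj : ∀ α : S, EnoughInjectives (D.C α))
    (α : S)
    [Abelian (ConfObj D)] [Abelian (ConfObj (D.restrict (Set.Iic α)))]
    [HasDerivedCategory.{w} (ConfObj D)]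
    [HasDerivedCategory.{w} (ConfObj (D.restrict (Set.Iic α)))]
    [HasDerivedCategory.{w} (D.C α)] :
    ∃ (i₀ : D.C α ⥤ ConfObj (D.restrict (Set.Iic α)))
      (j₀ : ConfObj (D.restrict (Set.Iic α)) ⥤ ConfObj D)
      (E : Db (D.C α) ⥤ Db (ConfObj D)),
      -- `i₀` is the extension by zero onto the closed point `α` of `U_α`,
      -- i.e. the right adjoint of the evaluation `i^*` at `α`:
      Nonempty (evalF (D.restrict (Set.Iic α)) ⟨α, Set.mem_Iic.mpr (le_refl α)⟩ ⊣ i₀) ∧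
      -- `j₀` is the extension by zero from the open subset `U_α`,
      -- i.e. the left adjoint of the restriction `j^*`:
      Nonempty (j₀ ⊣ resF D (Set.Iic α)) ∧
      -- `E` is the functor induced by `j₀ ∘ i₀` on bounded derived categories:
      Nonempty (toDb (D.C α) ⋙ E ≅ (i₀ ⋙ j₀) ⋙ toDb (ConfObj D)) ∧
      -- and it is fully faithful:
      E.Full ∧ E.Faithful := by
  have : ∀ {α β : S} (h : β ≤ α), PreservesFiniteColimits (D.φ h) := hφ
  have : ∀ t : Set.Iic α, Abelian ((D.restrict (Set.Iic α)).C t) := fun t =>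
    inferInstanceAs (Abelian (D.C t.1))
  have := preservesFiniteLimits_skyscraper D α
  have := preservesFiniteColimits_skyscraper D α
  have : PreservesFiniteLimits (evalAtTop D α) := inferInstanceAs
    (PreservesFiniteLimits (evalF (D.restrict (Set.Iic α)) (topIic α)))
  have : PreservesFiniteColimits (evalAtTop D α) := inferInstanceAs
    (PreservesFiniteColimits (evalF (D.restrict (Set.Iic α)) (topIic α)))
  have : (skyscraper D α).Additive := Functor.additive_of_preserves_binary_products _
  have : (evalAtTop D α).Additive := Functor.additive_of_preserves_binary_products _
  have : (extZero D (Set.Iic α)).Additive := Functor.additive_of_preserves_binary_products _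
  have : (resF D (Set.Iic α)).Additive := Functor.additive_of_preserves_binary_products _
  have h₁ := (adjunctionMapDerivedCategory (skyscraperAdjunction D α)).fullyFaithfulROfCompIsoId
    (mapDerivedCategoryCompIso (skyscraperCompEvalIso D α))
  have h₂ := (adjunctionMapDerivedCategory
    (extZeroAdjunction D (Set.Iic α) (isLowerSet_Iic α))).fullyFaithfulLOfCompIsoId
    (mapDerivedCategoryCompIso (extZeroCompResIso D (Set.Iic α)))
  have := h₁.full
  have := h₁.faithful
  have := h₂.full
  have := h₂.faithful
  have := mapDb_full (skyscraper D α)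
  have := mapDb_faithful (skyscraper D α)
  have := mapDb_full (extZero D (Set.Iic α))
  have := mapDb_faithful (extZero D (Set.Iic α))
  exact ⟨skyscraper D α, extZero D (Set.Iic α),
    mapDb (skyscraper D α) ⋙ mapDb (extZero D (Set.Iic α)), ⟨skyscraperAdjunction D α⟩,
    ⟨extZeroAdjunction D (Set.Iic α) (isLowerSet_Iic α)⟩,
    ⟨(Functor.associator _ _ _).symm ≪≫
      Functor.isoWhiskerRight (toDbCompMapDbIso (skyscraper D α)) _ ≪≫
      Functor.associator _ _ _ ≪≫
      Functor.isoWhiskerLeft _ (toDbCompMapDbIso (extZero D (Set.Iic α))) ≪≫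
      (Functor.associator _ _ _).symm⟩, inferInstance, inferInstance⟩
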